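/- arXiv:1003.5160 — 2 statements merged into one kernel-verified Lean document; each statement's English description precedes it below -/
import Mathlib

section
/- Let T be a tree on vertices 1,…,n with at least three pendant vertices, and let A be an n×n real T-TP matrix such that det A > 0 and, for every pendant vertex p of T, the principal submatrix of A obtained by deleting row p and column p is a P-matrix. Let σ : {1,…,n} → {+1,−1} be a sign function with σ_u = −σ_v for every edge {u,v} of T, normalized so that the diagonal entries of the adjugate ã of A are positive and sign(ã_{i,j}) = σ_iσ_j whenever this has been established. Then for any two distinct pendant vertices p_1 and p_2 of T, sign(ã_{p_1,p_2}) = σ_{p_1} · σ_{p_2}. -/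
open Matrix

/-- Every minor (rows and columns taken in increasing order) is positive. -/
def IsTotallyPositive {m : ℕ} (M : Matrix (Fin m) (Fin m) ℝ) : Prop :=
  ∀ (k : ℕ) (f g : Fin k → Fin m), StrictMono f → StrictMono g →
    0 < (M.submatrix f g).det

/-- `A` is T-TP: for every (induced) path of `T`, the submatrix of `A` whose rows and
columns are indexed by the vertices of the path, in path order, is totally positive. -/
def IsTTP {n : ℕ} (T : SimpleGraph (Fin n)) (A : Matrix (Fin n) (Fin n) ℝ) : Prop :=
  ∀ (u v : Fin n) (w : T.Walk u v), w.IsPath →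
    IsTotallyPositive (Matrix.of fun s t : Fin w.support.length =>
      A (w.support.get s) (w.support.get t))

/-- All principal minors are positive. -/
def IsPMatrix {m : Type*} [Fintype m] [DecidableEq m] (M : Matrix m m ℝ) : Prop :=
  ∀ s : Finset m, 0 < (M.submatrix (fun i : s => (i : m)) (fun i : s => (i : m))).det

/-- A pendant vertex: a vertex of degree one. -/
def Pendant {n : ℕ} (T : SimpleGraph (Fin n)) (p : Fin n) : Prop :=
  ∃! u : Fin n, T.Adj p u

/-- The principal submatrix obtained by deleting row `p` and column `p`. -/
def deleteVertex {n : ℕ} (A : Matrix (Fin n) (Fin n) ℝ) (p : Fin n) :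
    Matrix {i : Fin n // i ≠ p} {i : Fin n // i ≠ p} ℝ :=
  A.submatrix (fun i => (i : Fin n)) (fun i => (i : Fin n))

/-- `σ` is a ±1 sign function alternating along the edges of `T`. -/
def IsSigning {n : ℕ} (T : SimpleGraph (Fin n)) (σ : Fin n → ℝ) : Prop :=
  (∀ i, σ i = 1 ∨ σ i = -1) ∧ ∀ u v : Fin n, T.Adj u v → σ u = -σ v

/-- Submatrices of a P-matrix along an injection are P-matrices. -/
theorem IsPMatrix.submatrix {m ι : Type*} [Fintype m] [DecidableEq m] [Fintype ι] [DecidableEq ι]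
    {M : Matrix m m ℝ} (hM : IsPMatrix M) {f : ι → m} (hf : Function.Injective f) :
    IsPMatrix (M.submatrix f f) := by
  intro s
  let e : s ≃ s.image f :=
    (Equiv.Set.image f (s : Set ι) hf).trans (Equiv.setCongr (by simp))
  have h := hM (s.image f)
  rw [← Matrix.det_submatrix_equiv_self e] at h
  exact h

theorem IsPMatrix.det_pos {m : Type*} [Fintype m] [DecidableEq m]
    {M : Matrix m m ℝ} (hM : IsPMatrix M) : 0 < M.det := by
  have h := hM Finset.univ
  rw [← Matrix.det_submatrix_equiv_self (Equiv.subtypeUnivEquiv Finset.mem_univ).symm] at h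
  exact h

section Adjugate

variable {V : Type*} [Fintype V] [DecidableEq V]

/-- The principal submatrix obtained by deleting the index `p`, for an arbitrary index type. -/
abbrev Matrix.deleteIndex (A : Matrix V V ℝ) (p : V) : Matrix {i : V // i ≠ p} {i : V // i ≠ p} ℝ :=
  A.submatrix Subtype.val Subtype.val

theorem Matrix.adjugate_self_eq_det_deleteIndex (A : Matrix V V ℝ) (p : V) :
    A.adjugate p p = (A.deleteIndex p).det := by
  rw [Matrix.adjugate_apply, Matrix.twoBlockTriangular_det _ (fun i => i ≠ p)]
  · have h2 : ((A.updateRow p (Pi.single p 1)).toSquareBlockProp fun i => ¬ i ≠ p).det = 1 := by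
      have : Unique {i // ¬ i ≠ p} := ⟨⟨⟨p, by simp⟩⟩, fun x => Subtype.ext (not_not.mp x.2)⟩
      rw [Matrix.det_unique]
      have := not_not.mp (default : {i // ¬ i ≠ p}).2
      simp [Matrix.toSquareBlockProp, this]
    rw [h2, mul_one]
    congr 1
    ext i j
    simp [Matrix.toSquareBlockProp, i.2]
  · intro i hi j hj
    obtain rfl := not_not.mp hi
    simp [hj]

/-- Jacobi's identity for two by two minors of the adjugate. -/
theorem Matrix.adjugate_mul_sub_mul_eq (A : Matrix V V ℝ) (p : V)
    (hp : (A.deleteIndex p).det ≠ 0) (i j : {i : V // i ≠ p}) :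
    A.adjugate i j * A.adjugate p p - A.adjugate i p * A.adjugate p j =
      A.det * (A.deleteIndex p).adjugate i j := by
  set B := A.deleteIndex p with hB
  let C : Matrix {i : V // i ≠ p} {i : V // i ≠ p} ℝ :=
    Matrix.of fun i j => A.adjugate i j * A.adjugate p p - A.adjugate i p * A.adjugate p j
  have split : ∀ (l k : V), A l p * A.adjugate p k +
      ∑ x : {i : V // i ≠ p}, A l x * A.adjugate x k = (A * A.adjugate) l k := by
    intro l k
    rw [Matrix.mul_apply]
    exact (Fintype.sum_eq_add_sum_subtype_ne (fun x => A l x * A.adjugate x k) p).symm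
  have hBC : B * C = (A.det * B.det) • (1 : Matrix {i : V // i ≠ p} {i : V // i ≠ p} ℝ) := by
    ext l k
    have h1 := split l k
    have h2 := split l p
    rw [Matrix.mul_adjugate] at h1 h2
    simp only [Matrix.smul_apply, smul_eq_mul, Matrix.one_apply_ne l.2, mul_zero] at h1 h2
    have h3 : (1 : Matrix V V ℝ) l k = (1 : Matrix {i : V // i ≠ p} {i : V // i ≠ p} ℝ) l k := by
      simp [Matrix.one_apply, Subtype.ext_iff]
    rw [h3] at h1
    have h4 : (B * C) l k = (∑ x : {i : V // i ≠ p}, A l x * A.adjugate x k) * A.adjugate p p -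
        (∑ x : {i : V // i ≠ p}, A l x * A.adjugate x p) * A.adjugate p k := by
      rw [Matrix.mul_apply, Finset.sum_mul, Finset.sum_mul, ← Finset.sum_sub_distrib]
      refine Finset.sum_congr rfl fun x _ => ?_
      simp only [hB, C, Matrix.deleteIndex, Matrix.submatrix_apply, Matrix.of_apply]
      ring
    rw [h4, Matrix.smul_apply, smul_eq_mul, ← A.adjugate_self_eq_det_deleteIndex p]
    linear_combination A.adjugate p p * h1 - A.adjugate p k * h2
  have h5 : B.det • C = B.det • (A.det • B.adjugate) := by
    calc B.det • C = B.adjugate * (B * C) := by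
          rw [← Matrix.mul_assoc, Matrix.adjugate_mul, Matrix.smul_mul, Matrix.one_mul]
      _ = B.det • (A.det • B.adjugate) := by
          rw [hBC, Matrix.mul_smul, Matrix.mul_one, smul_smul, mul_comm]
  have h6 := congrFun (congrFun (smul_right_injective _ hp h5) i) j
  simpa [C] using h6

end Adjugate

section Tree

variable {V : Type*} {G : SimpleGraph V}

theorem SimpleGraph.IsTree.comap_ne [Fintype V] [DecidableEq V] (hG : G.IsTree) {p : V}
    (hp : ∃! u, G.Adj p u) : (G.comap (Subtype.val : {v // v ≠ p} → V)).IsTree := by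
  classical
  refine ⟨?_, hG.isAcyclic.of_comap (Function.Embedding.subtype _)⟩
  exact hG.connected.induce_compl_singleton_of_degree_eq_one
    ((G.degree_eq_one_iff_existsUnique_adj).2 hp)

/-- If a leaf is removed, then every other leaf remains a leaf when a third vertex exists. -/
theorem SimpleGraph.IsTree.existsUnique_adj_comap_ne [Fintype V] [DecidableEq V] (hG : G.IsTree)
    {p q r : V} (hp : ∃! u, G.Adj p u) (hq : ∃! u, G.Adj q u) (hqp : q ≠ p) (hrp : r ≠ p)
    (hqr : q ≠ r) :
    ∃! u, (G.comap (Subtype.val : {v // v ≠ p} → V)).Adj ⟨q, hqp⟩ u := by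
  classical
  have : Nontrivial {v // v ≠ p} := ⟨⟨q, hqp⟩, ⟨r, hrp⟩, by simpa using hqr⟩
  have hpos := (hG.comap_ne hp).connected.preconnected.degree_pos_of_nontrivial ⟨q, hqp⟩
  obtain ⟨u, hu⟩ := (SimpleGraph.degree_pos_iff_exists_adj _ _).1 hpos
  exact ⟨u, hu, fun y hy => Subtype.ext (hq.unique hy hu)⟩

/-- A tree with a vertex off the path from `a` to `b` has a leaf off that path. -/
theorem SimpleGraph.IsTree.exists_leaf_notMem_support [Finite V] (hG : G.IsTree) {a b x : V}
    {w : G.Walk a b} (hw : w.IsPath) (hx : x ∉ w.support) :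
    ∃ v ∉ w.support, ∃! u, G.Adj v u := by
  classical
  choose P hP _ using fun v => hG.existsUnique_path a v
  obtain ⟨v, hv, hmax⟩ := Set.exists_max_image {v | v ∉ w.support} (fun v => (P v).length)
    (Set.toFinite _) ⟨x, hx⟩
  have hva : v ≠ a := fun h => hv (h ▸ w.start_mem_support)
  have hnil : ¬ (P v).Nil := SimpleGraph.Walk.not_nil_of_ne hva.symm
  refine ⟨v, hv, (P v).penultimate, ((P v).adj_penultimate hnil).symm, fun u hu => ?_⟩
  by_contra hne
  have hus : u ∉ (P v).support :=
    fun h => hne (hG.isAcyclic.eq_penultimate_of_adj_end (hP v) hu h)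
  have hc := (hP v).concat hus hu
  by_cases huw : u ∈ w.support
  · have h := (hG.existsUnique_path a u).unique (hw.takeUntil huw) hc
    apply hv
    apply w.support_takeUntil_subset_support huw
    rw [h]
    exact (P v).support_subset_support_concat _ (P v).end_mem_support
  · have h := (hG.existsUnique_path a u).unique (hP u) hc
    have := hmax u huw
    rw [h, SimpleGraph.Walk.length_concat] at this
    omega

theorem SimpleGraph.Walk.sign_mul_sign {σ : V → ℝ} (hσ : ∀ i, σ i = 1 ∨ σ i = -1)
    (hadj : ∀ u v, G.Adj u v → σ u = -σ v) {a b : V} (w : G.Walk a b) :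
    σ a * σ b = (-1) ^ w.length := by
  induction w with
  | nil => rename_i a; rcases hσ a with h | h <;> simp [h]
  | cons h p ih => rw [hadj _ _ h, neg_mul, ih, SimpleGraph.Walk.length_cons, pow_succ]; ring

/-- For every path, the submatrix whose rows omit the last vertex and whose columns omit the
first vertex has positive determinant. -/
def PathCornerMinorsPos (G : SimpleGraph V) (A : Matrix V V ℝ) : Prop :=
  ∀ (u v : V) (w : G.Walk u v), w.IsPath →
    0 < (A.submatrix (fun i : Fin w.length => w.getVert i)
      (fun i : Fin w.length => w.getVert (i + 1))).det

theorem PathCornerMinorsPos.comap {A : Matrix V V ℝ} (h : PathCornerMinorsPos G A) {W : Type*}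
    (f : W ↪ V) : PathCornerMinorsPos (G.comap f) (A.submatrix f f) := by
  intro u v w hw
  let φ : G.comap f →g G := ⟨f, fun hab => hab⟩
  have hlen : w.length = (w.map φ).length := (SimpleGraph.Walk.length_map φ w).symm
  have := h _ _ (w.map φ) (hw.map f.injective)
  rw [← Matrix.det_submatrix_equiv_self (finCongr hlen)] at this
  convert this using 2
  ext i j
  simp only [Matrix.submatrix_apply, finCongr_apply, Fin.val_cast]
  rw [SimpleGraph.Walk.getVert_map, SimpleGraph.Walk.getVert_map]
  rfl

/-- The corner entry of the adjugate along a spanning path. -/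
theorem PathCornerMinorsPos.adjugate_pos_of_spanning [Fintype V] [DecidableEq V]
    {A : Matrix V V ℝ} (h : PathCornerMinorsPos G A) {σ : V → ℝ} (hσ : ∀ i, σ i = 1 ∨ σ i = -1)
    (hadj : ∀ u v, G.Adj u v → σ u = -σ v) {a b : V} {w : G.Walk a b} (hw : w.IsPath)
    (hspan : ∀ v, v ∈ w.support) : 0 < σ a * σ b * A.adjugate a b := by
  have hbij : Function.Bijective (fun i : Fin (w.length + 1) => w.getVert i) := by
    constructor
    · intro i j hij
      exact Fin.ext (hw.getVert_injOn (Nat.lt_succ_iff.mp i.2) (Nat.lt_succ_iff.mp j.2) hij)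
    · intro v
      obtain ⟨k, hk, hkl⟩ := SimpleGraph.Walk.mem_support_iff_exists_getVert.1 (hspan v)
      exact ⟨⟨k, Nat.lt_succ_of_le hkl⟩, hk⟩
  let e := Equiv.ofBijective _ hbij
  have h0 : e 0 = a := by simp [e]
  have h1 : e (Fin.last _) = b := by simp [e]
  have h2 : A.adjugate a b = (A.submatrix e e).adjugate 0 (Fin.last _) := by
    rw [Matrix.adjugate_submatrix_equiv_self, Matrix.submatrix_apply, h0, h1]
  rw [h2, Matrix.adjugate_fin_succ_eq_det_submatrix, w.sign_mul_sign hσ hadj, ← mul_assoc]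
  have h3 := h a b w hw
  have h4 : (-1 : ℝ) ^ w.length * (-1) ^ ((Fin.last w.length : ℕ) + (0 : Fin (w.length + 1))) = 1 := by
    simp [← mul_pow]
  rw [h4, one_mul]
  convert h3 using 2
  ext i j
  simp [e]

/-- The inequalities between signed adjugate entries force positivity. -/
theorem pos_of_cyclic_minor_pos {b11 b22 b33 b12 b13 b23 b31 b32 : ℝ}
    (h11 : 0 < b11) (h22 : 0 < b22) (h33 : 0 < b33)
    (h12 : 0 < b12 * b33 - b13 * b32) (h13 : 0 < b13 * b22 - b12 * b23)
    (h32 : 0 < b32 * b11 - b31 * b12)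
    (hm23 : 0 < b22 * b33 - b23 * b32) (hm13 : 0 < b11 * b33 - b13 * b31) : 0 < b12 := by
  by_contra! hb
  have hneg : b13 * b32 < 0 := by nlinarith
  rcases mul_neg_iff.1 hneg with ⟨h1, h2⟩ | ⟨h1, h2⟩
  · have hc : b31 * b12 < 0 := by nlinarith
    rcases mul_neg_iff.1 hc with ⟨h3, h4⟩ | ⟨h3, h4⟩
    · have e1 : (-b12) * b33 < b13 * (-b32) := by linarith
      have e2 : (-b32) * b11 < b31 * (-b12) := by linarith
      have := mul_lt_mul'' e1 e2 (by nlinarith) (by nlinarith)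
      have : 0 < (b12 * b32) * (b13 * b31 - b11 * b33) := by linarith
      nlinarith [mul_pos_of_neg_of_neg h4 h2]
    · linarith
  · have hc : b12 * b23 < 0 := by nlinarith
    rcases mul_neg_iff.1 hc with ⟨h3, h4⟩ | ⟨h3, h4⟩
    · linarith
    · have e1 : (-b12) * b33 < (-b13) * b32 := by linarith
      have e2 : (-b13) * b22 < (-b12) * b23 := by linarith
      have := mul_lt_mul'' e1 e2 (by nlinarith) (by nlinarith)
      have : 0 < (b12 * b13) * (b23 * b32 - b22 * b33) := by linarith
      nlinarith [mul_pos_of_neg_of_neg h3 h1]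

end Tree

/-- Signed adjugate entries between distinct leaves are positive, by induction on the number of
vertices: a leaf off the path between the two given leaves is removed. -/
theorem adjugate_leaf_leaf_pos (N : ℕ) {V : Type*} [Fintype V] [DecidableEq V]
    (hN : Fintype.card V = N) {G : SimpleGraph V}
    (hG : G.IsTree) {A : Matrix V V ℝ} (hA : PathCornerMinorsPos G A) (hdet : 0 < A.det)
    (hP : ∀ p, (∃! u, G.Adj p u) → IsPMatrix (A.deleteIndex p))
    {σ : V → ℝ} (hσ : ∀ i, σ i = 1 ∨ σ i = -1) (hadj : ∀ u v, G.Adj u v → σ u = -σ v)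
    {p₁ p₂ : V} (hp₁ : ∃! u, G.Adj p₁ u) (hp₂ : ∃! u, G.Adj p₂ u) (hne : p₁ ≠ p₂) :
    0 < σ p₁ * σ p₂ * A.adjugate p₁ p₂ := by
  induction N using Nat.strong_induction_on generalizing V with
  | _ N ih =>
  obtain ⟨w, hw, -⟩ := hG.existsUnique_path p₁ p₂
  by_cases hspan : ∀ v, v ∈ w.support
  · exact hA.adjugate_pos_of_spanning hσ hadj hw hspan
  push Not at hspan
  obtain ⟨x, hx⟩ := hspan
  obtain ⟨p₃, h3w, hp₃⟩ := hG.exists_leaf_notMem_support hw hx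
  have h13 : p₁ ≠ p₃ := fun h => h3w (h ▸ w.start_mem_support)
  have h23 : p₂ ≠ p₃ := fun h => h3w (h ▸ w.end_mem_support)
  have sq : ∀ i, σ i * σ i = 1 := fun i => by rcases hσ i with h | h <;> simp [h]
  have off : ∀ a b c, (∃! u, G.Adj a u) → (∃! u, G.Adj b u) → (∃! u, G.Adj c u) →
      a ≠ b → a ≠ c → b ≠ c →
      0 < (σ a * σ b * A.adjugate a b) * A.adjugate c c -
        (σ a * σ c * A.adjugate a c) * (σ c * σ b * A.adjugate c b) := by
    intro a b c ha hb hc hab hac hbc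
    have hB : IsPMatrix (A.deleteIndex c) := hP c hc
    have key := ih (Fintype.card {v // v ≠ c}) (hN ▸ Fintype.card_subtype_lt (x := c) (by simp))
      rfl (hG.comap_ne hc) (hA.comap (Function.Embedding.subtype _)) hB.det_pos
      (fun q _ => hB.submatrix Subtype.val_injective) (fun i => hσ i)
      (fun u v h => hadj u v h)
      (hG.existsUnique_adj_comap_ne hc ha hac hbc hab)
      (hG.existsUnique_adj_comap_ne hc hb hbc hac hab.symm)
      (by simpa using hab)
    have jac := A.adjugate_mul_sub_mul_eq c hB.det_pos.ne' ⟨a, hac⟩ ⟨b, hbc⟩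
    have := mul_pos hdet key
    have e : (σ a * σ b * A.adjugate a b) * A.adjugate c c -
        (σ a * σ c * A.adjugate a c) * (σ c * σ b * A.adjugate c b) =
        A.det * (σ a * σ b * (A.deleteIndex c).adjugate ⟨a, hac⟩ ⟨b, hbc⟩) := by
      linear_combination σ a * σ b * jac - σ a * σ b * A.adjugate a c * A.adjugate c b * sq c
    rw [e]
    exact this
  have diag : ∀ c, (∃! u, G.Adj c u) → 0 < A.adjugate c c := fun c hc => by
    rw [A.adjugate_self_eq_det_deleteIndex]
    exact (hP c hc).det_pos
  have minor : ∀ a c, (∃! u, G.Adj c u) → a ≠ c →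
      0 < A.adjugate a a * A.adjugate c c -
        (σ a * σ c * A.adjugate a c) * (σ c * σ a * A.adjugate c a) := by
    intro a c hc hac
    have hB : IsPMatrix (A.deleteIndex c) := hP c hc
    have jac := A.adjugate_mul_sub_mul_eq c hB.det_pos.ne' ⟨a, hac⟩ ⟨a, hac⟩
    rw [Matrix.adjugate_self_eq_det_deleteIndex (A.deleteIndex c)] at jac
    have := mul_pos hdet (hB.submatrix (Subtype.val_injective (p := fun i => i ≠ ⟨a, hac⟩))).det_pos
    rw [← jac] at this
    have e : (σ a * σ c * A.adjugate a c) * (σ c * σ a * A.adjugate c a) =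
        A.adjugate a c * A.adjugate c a := by
      linear_combination A.adjugate a c * A.adjugate c a * (σ a * σ a * sq c + sq a)
    rw [e]
    exact this
  exact pos_of_cyclic_minor_pos (diag p₁ hp₁) (diag p₂ hp₂) (diag p₃ hp₃)
    (off p₁ p₂ p₃ hp₁ hp₂ hp₃ hne h13 h23) (off p₁ p₃ p₂ hp₁ hp₃ hp₂ h13 hne h23.symm)
    (off p₃ p₂ p₁ hp₃ hp₂ hp₁ h23.symm h13.symm hne.symm)
    (minor p₂ p₃ hp₃ h23) (minor p₁ p₃ hp₃ h13)

theorem IsTTP.pathCornerMinorsPos {n : ℕ} {T : SimpleGraph (Fin n)}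
    {A : Matrix (Fin n) (Fin n) ℝ} (h : IsTTP T A) : PathCornerMinorsPos T A := by
  intro u v w hw
  have := h u v w hw w.length
    (fun i => ⟨i, by rw [SimpleGraph.Walk.length_support]; omega⟩)
    (fun i => ⟨i + 1, by rw [SimpleGraph.Walk.length_support]; omega⟩)
    (fun i j hij => hij) (fun i j hij => Nat.succ_lt_succ hij)
  convert this using 2
  ext i j
  simp [SimpleGraph.Walk.support_getElem_eq_getVert]

/-- Lemma 2.4: if `T` has at least three pendant vertices, then for any two distinct
pendant vertices `p₁, p₂`, `sign(ã_{p₁,p₂}) = σ_{p₁} σ_{p₂}`. -/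
theorem ttp_adjugate_sign_pendant_pendant {n : ℕ} (T : SimpleGraph (Fin n)) (hT : T.IsTree)
    (q₁ q₂ q₃ : Fin n) (hq12 : q₁ ≠ q₂) (hq13 : q₁ ≠ q₃) (hq23 : q₂ ≠ q₃)
    (hq₁ : Pendant T q₁) (hq₂ : Pendant T q₂) (hq₃ : Pendant T q₃)
    (A : Matrix (Fin n) (Fin n) ℝ) (hTTP : IsTTP T A) (hdet : 0 < A.det)
    (hP : ∀ p : Fin n, Pendant T p → IsPMatrix (deleteVertex A p))
    (σ : Fin n → ℝ) (hσ : IsSigning T σ)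
    (p₁ p₂ : Fin n) (hp₁ : Pendant T p₁) (hp₂ : Pendant T p₂) (hne : p₁ ≠ p₂) :
    0 < σ p₁ * σ p₂ * A.adjugate p₁ p₂ := by
  exact adjugate_leaf_leaf_pos n (Fintype.card_fin n) hT hTTP.pathCornerMinorsPos hdet
    (fun p hp => hP p hp) hσ.1 hσ.2 hp₁ hp₂ hne
end

section
/- Let T be a tree on vertices 1,…,n and let A be an n×n real T-TP matrix such that det A > 0 and, for every pendant vertex q of T, the principal submatrix of A obtained by deleting row q and column q is a P-matrix. Let σ : {1,…,n} → {+1,−1} be a sign function with σ_u = −σ_v for every edge {u,v} of T, normalized so that the diagonal entries of the adjugate ã of A are positive. Then for every pendant vertex p of T and every index 1 ≤ i ≤ n, sign(ã_{p,i}) = σ_p · σ_i; in particular ã_{p,p} > 0. -/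
open Matrix

/-- Dominance of `P`, `Q` over the cyclic products forces `x` to be positive. -/
lemma pos_of_cyclic_dominance {x y a b P Q : ℝ} (hP : 0 < P) (ha : 0 ≤ a)
    (hx : a * y < x * Q) (hy : b * x < y * P) (hab : a * b < P * Q) : 0 < x := by
  nlinarith [mul_lt_mul_of_pos_right hx hP, mul_le_mul_of_nonneg_left hy.le ha]

namespace SimpleGraph

variable {V : Type*} {T : SimpleGraph V}

/-- A path from `p` in a finite tree through another vertex `x` extends to end in a leaf. -/
lemma IsTree.exists_isPath_to_leaf [Finite V] (hT : T.IsTree) {p x : V} (hx : x ≠ p) :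
    ∃ (v : V) (w : T.Walk p v), w.IsPath ∧ x ∈ w.support ∧ v ≠ p ∧ ∃! u, T.Adj v u := by
  classical
  have := Fintype.ofFinite V
  let s := {n | ∃ (v : V) (w : T.Walk p v), w.IsPath ∧ x ∈ w.support ∧ w.length = n}
  have hs : s.Finite := (Set.finite_lt_nat (Fintype.card V)).subset
    fun n ⟨_, _, hw, _, hn⟩ ↦ hn ▸ hw.length_lt
  obtain ⟨w₀, hw₀⟩ := hT.connected.exists_isPath p x
  obtain ⟨_, ⟨v, w, hw, hxw, rfl⟩, hmax⟩ := hs.exists_maximal ⟨_, x, w₀, hw₀, by simp, rfl⟩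
  have hvp : v ≠ p := by
    rintro rfl
    have := Walk.nil_iff_support_eq.mp (Walk.isPath_iff_nil.mp hw)
    exact hx (by simpa [this] using hxw)
  refine ⟨v, w, hw, hxw, hvp, w.penultimate,
    (w.adj_penultimate (Walk.not_nil_of_ne hvp.symm)).symm, fun u hu ↦ ?_⟩
  refine hT.isAcyclic.eq_penultimate_of_adj_end hw hu ?_
  by_contra hnot
  have := hmax (y := (w.concat hu).length)
    ⟨u, w.concat hu, hw.concat hnot hu, w.support_subset_support_concat _ hxw, rfl⟩
    (by simp [Walk.length_concat])
  simp [Walk.length_concat] at this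

/-- A finite nontrivial tree with at most one leaf besides `p` has a path from `p`
through all its vertices. -/
lemma IsTree.exists_isPath_covering [Finite V] [Nontrivial V] (hT : T.IsTree) (p : V)
    (h : ∀ q r, q ≠ p → r ≠ p → (∃! u, T.Adj q u) → (∃! u, T.Adj r u) → q = r) :
    ∃ (v : V) (w : T.Walk p v), w.IsPath ∧ ∀ x, x ∈ w.support := by
  obtain ⟨x, hx⟩ := exists_ne p
  obtain ⟨v, w, hw, -, hv, hv'⟩ := hT.exists_isPath_to_leaf hx
  refine ⟨v, w, hw, fun y ↦ ?_⟩
  obtain rfl | hy := eq_or_ne y p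
  · simp
  obtain ⟨v', w', hw', hyw', hne, hleaf⟩ := hT.exists_isPath_to_leaf hy
  obtain rfl := h v v' hv hne hv' hleaf
  rwa [(hT.existsUnique_path p v).unique hw hw']

lemma IsTree.induce_ne_of_existsUnique_adj (hT : T.IsTree) {q : V} (hq : ∃! u, T.Adj q u) :
    (T.induce {i | i ≠ q}).IsTree := by
  obtain ⟨u, hu, huniq⟩ := hq
  have : Nonempty {i | i ≠ q} := ⟨u, hu.ne'⟩
  refine ⟨⟨hT.connected.preconnected.induce_of_degree_eq_one fun v hv ↦ ?_⟩,
    hT.isAcyclic.induce _⟩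
  obtain rfl : v = q := by simpa using hv
  intro a ha b hb
  rw [huniq a ha, huniq b hb]

/-- A leaf stays a leaf when another leaf is removed from a tree with a third vertex. -/
lemma IsTree.existsUnique_adj_induce_ne (hT : T.IsTree) {p q r : V}
    (hp : ∃! u, T.Adj p u) (hq : ∃! u, T.Adj q u) (hpq : p ≠ q) (hpr : p ≠ r) (hqr : q ≠ r) :
    ∃! u, (T.induce {i | i ≠ q}).Adj ⟨p, hpq⟩ u := by
  have hne : (⟨p, hpq⟩ : {i | i ≠ q}) ≠ ⟨r, hqr.symm⟩ := by simpa using hpr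
  have : Nontrivial {i | i ≠ q} := ⟨_, _, hne⟩
  obtain ⟨u, hu⟩ :=
    (hT.induce_ne_of_existsUnique_adj hq).connected.preconnected.exists_adj_of_nontrivial
      ⟨p, hpq⟩
  exact ⟨u, hu, fun v hv ↦ Subtype.ext (hp.unique hv hu)⟩

end SimpleGraph

namespace Matrix

variable {V : Type*} [Fintype V] [DecidableEq V]

lemma adjugate_apply_self_eq_det_submatrix (A : Matrix V V ℝ) (q : V) :
    A.adjugate q q = (A.submatrix (Subtype.val : {i // i ≠ q} → V) Subtype.val).det := by
  rw [adjugate_apply, twoBlockTriangular_det _ (fun i ↦ i ≠ q)]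
  · have h₁ : (toSquareBlockProp (A.updateRow q (Pi.single q 1)) fun i ↦ i ≠ q) =
        A.submatrix (Subtype.val : {i // i ≠ q} → V) Subtype.val := by
      ext i j
      simp [toSquareBlockProp, updateRow_ne i.2]
    have h₂ : (toSquareBlockProp (A.updateRow q (Pi.single q 1)) fun i ↦ ¬ i ≠ q) = 1 := by
      ext ⟨i, hi⟩ ⟨j, hj⟩
      obtain rfl : i = q := not_not.mp hi
      obtain rfl : j = i := not_not.mp hj
      simp [toSquareBlockProp]
    rw [h₁, h₂, det_one, mul_one]
  · intro i hi j hj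
    obtain rfl := not_not.mp hi
    simp [hj]

lemma inv_apply_self_pos {A : Matrix V V ℝ} (hA : 0 < A.det) {q : V}
    (hq : 0 < (A.submatrix (Subtype.val : {i // i ≠ q} → V) Subtype.val).det) :
    0 < A⁻¹ q q := by
  rw [inv_def, smul_apply, adjugate_apply_self_eq_det_submatrix, Ring.inverse_eq_inv', smul_eq_mul]
  positivity

/-- The inverse of a principal submatrix is a Schur complement in the inverse. -/
lemma inv_submatrix_ne {A : Matrix V V ℝ} (hA : IsUnit A.det) {q : V} (hq : A⁻¹ q q ≠ 0) :
    (A.submatrix (Subtype.val : {i // i ≠ q} → V) Subtype.val)⁻¹ =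
      of fun i j : {i // i ≠ q} ↦ A⁻¹ i j - A⁻¹ i q * A⁻¹ q j / A⁻¹ q q := by
  apply inv_eq_left_inv
  have hmul (i k : V) : ∑ j, A⁻¹ i j * A j k = (1 : Matrix V V ℝ) i k := by
    rw [← mul_apply, nonsing_inv_mul _ hA]
  ext i k
  have hsum : ∑ j : V, (A⁻¹ i j - A⁻¹ i q * A⁻¹ q j / A⁻¹ q q) * A j k =
      (1 : Matrix V V ℝ) i k := by
    calc _ = ∑ j, A⁻¹ i j * A j k - A⁻¹ i q / A⁻¹ q q * ∑ j, A⁻¹ q j * A j k := by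
          rw [Finset.mul_sum, ← Finset.sum_sub_distrib]
          exact Finset.sum_congr rfl fun j _ ↦ by ring
      _ = _ := by rw [hmul, hmul, one_apply_ne k.2.symm, mul_zero, sub_zero]
  rw [← Fintype.sum_subtype_add_sum_subtype (fun j ↦ j ≠ q)] at hsum
  have hzero : ∑ j : {j // ¬ j ≠ q}, (A⁻¹ i j - A⁻¹ i q * A⁻¹ q j / A⁻¹ q q) * A j k = 0 := by
    refine Finset.sum_eq_zero fun ⟨j, hj⟩ _ ↦ ?_
    obtain rfl := not_not.mp hj
    rw [mul_div_cancel_right₀ _ hq, sub_self, zero_mul]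
  rw [hzero, add_zero] at hsum
  rw [mul_apply]
  refine hsum.trans ?_
  simp [one_apply, Subtype.ext_iff]

end Matrix

lemma IsTotallyPositive.inv_zero_apply_sign {m : ℕ} {M : Matrix (Fin (m + 1)) (Fin (m + 1)) ℝ}
    (hM : IsTotallyPositive M) (k : Fin (m + 1)) : 0 < (-1) ^ (k : ℕ) * M⁻¹ 0 k := by
  have hdet : 0 < M.det := by simpa using hM _ id id strictMono_id strictMono_id
  have hminor := hM m k.succAbove (Fin.succAbove 0) (Fin.strictMono_succAbove _)
    (Fin.strictMono_succAbove _)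
  rw [Matrix.inv_def, Matrix.smul_apply, adjugate_fin_succ_eq_det_submatrix,
    Ring.inverse_eq_inv', smul_eq_mul]
  have hsign : ((-1 : ℝ) ^ (k : ℕ)) * (-1) ^ (k : ℕ) = 1 := by rw [← mul_pow]; simp
  have : (-1 : ℝ) ^ (k : ℕ) * (M.det⁻¹ * ((-1) ^ ((k : ℕ) + ((0 : Fin (m + 1)) : ℕ)) *
      (M.submatrix k.succAbove (Fin.succAbove 0)).det)) =
      M.det⁻¹ * (M.submatrix k.succAbove (Fin.succAbove 0)).det := by
    rw [Fin.val_zero, add_zero]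
    linear_combination M.det⁻¹ * (M.submatrix k.succAbove (Fin.succAbove 0)).det * hsign
  rw [this]
  positivity

/-- The matrix of a path read off by `getVert`. -/
def pathMatrix {V : Type*} {T : SimpleGraph V} (A : Matrix V V ℝ) {u v : V} (w : T.Walk u v) :
    Matrix (Fin (w.length + 1)) (Fin (w.length + 1)) ℝ :=
  A.submatrix (fun s ↦ w.getVert s) (fun s ↦ w.getVert s)

lemma IsTTP.pathMatrix {n : ℕ} {T : SimpleGraph (Fin n)} {A : Matrix (Fin n) (Fin n) ℝ}
    (h : IsTTP T A) {u v : Fin n} {w : T.Walk u v} (hw : w.IsPath) :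
    IsTotallyPositive (pathMatrix A w) := by
  intro k f g hf hg
  have := h u v w hw k (fun i ↦ (f i).cast w.length_support.symm)
    (fun i ↦ (g i).cast w.length_support.symm) (fun _ _ hij ↦ hf hij) (fun _ _ hij ↦ hg hij)
  convert this using 2
  ext i j
  simp [_root_.pathMatrix, SimpleGraph.Walk.getVert_eq_support_getElem, Nat.lt_succ_iff.mp (f i).2,
    Nat.lt_succ_iff.mp (g j).2]

section

variable {V : Type*} {T : SimpleGraph V} {σ : V → ℝ} {p : V}

lemma sign_getVert (hσ : ∀ u v, T.Adj u v → σ u = -σ v) {v : V} (w : T.Walk p v) :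
    ∀ k ≤ w.length, σ (w.getVert k) = (-1) ^ k * σ p
  | 0, _ => by simp
  | k + 1, hk => by
    have := hσ _ _ (w.adj_getVert_succ (i := k) (by omega))
    rw [sign_getVert hσ w k (by omega)] at this
    rw [pow_succ]
    linarith

/-- The sign pattern of the first row of the inverse along a path through all vertices. -/
lemma inv_sign_of_isPath_covering [Fintype V] [DecidableEq V] {A : Matrix V V ℝ}
    (hσ₁ : ∀ i, σ i * σ i = 1)
    (hσ : ∀ u v, T.Adj u v → σ u = -σ v) {v : V} {w : T.Walk p v} (hw : w.IsPath)
    (hcov : ∀ x, x ∈ w.support) (hTP : IsTotallyPositive (pathMatrix A w)) (i : V) :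
    0 < σ p * σ i * A⁻¹ p i := by
  have hbij : Function.Bijective (fun s : Fin (w.length + 1) ↦ w.getVert s) := by
    constructor
    · intro a b hab
      exact Fin.ext (hw.getVert_injOn (Nat.lt_succ_iff.mp a.2) (Nat.lt_succ_iff.mp b.2) hab)
    · intro x
      obtain ⟨k, hk, hle⟩ := SimpleGraph.Walk.mem_support_iff_exists_getVert.mp (hcov x)
      exact ⟨⟨k, Nat.lt_succ_iff.mpr hle⟩, hk⟩
  let e := Equiv.ofBijective _ hbij
  obtain ⟨k, rfl⟩ := e.surjective i
  have hM : pathMatrix A w = A.submatrix e e := rfl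
  have hpos := hTP.inv_zero_apply_sign k
  rw [hM, Matrix.inv_submatrix_equiv, Matrix.submatrix_apply] at hpos
  have he0 : e 0 = p := w.getVert_zero
  have hek : σ (e k) = (-1) ^ (k : ℕ) * σ p := sign_getVert hσ w k (Nat.lt_succ_iff.mp k.2)
  rw [he0] at hpos
  rw [hek]
  calc 0 < _ := hpos
    _ = _ := by linear_combination -(-1) ^ (k : ℕ) * A⁻¹ p (e k) * hσ₁ p

end

/-- Total positivity along paths passes to induced subgraphs. -/
lemma isTotallyPositive_pathMatrix_induce {V : Type*} {T : SimpleGraph V} {A : Matrix V V ℝ}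
    (hTP : ∀ (u v : V) (w : T.Walk u v), w.IsPath → IsTotallyPositive (pathMatrix A w))
    (s : Set V) {u v : s} {w : (T.induce s).Walk u v} (hw : w.IsPath) :
    IsTotallyPositive (pathMatrix (A.submatrix Subtype.val Subtype.val) w) := by
  let φ : T.induce s →g T := (SimpleGraph.Embedding.induce s).toHom
  have hlen : (w.map φ).length = w.length := w.length_map φ
  intro k f g hf hg
  have := hTP _ _ (w.map φ) (hw.map Subtype.val_injective) k
    (fun i ↦ (f i).cast (by rw [hlen])) (fun i ↦ (g i).cast (by rw [hlen]))
    (fun _ _ hij ↦ hf hij) (fun _ _ hij ↦ hg hij)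
  convert this using 2
  ext i j
  exact congrArg₂ A (w.getVert_map φ (f i)).symm (w.getVert_map φ (g j)).symm

/-- The sign pattern of a pendant row of the inverse, over an arbitrary finite vertex type. -/
theorem inv_sign_pendant_row {V : Type*} [Fintype V] [DecidableEq V] {T : SimpleGraph V}
    (hT : T.IsTree) {A : Matrix V V ℝ}
    (hTP : ∀ (u v : V) (w : T.Walk u v), w.IsPath → IsTotallyPositive (pathMatrix A w))
    (hdet : 0 < A.det)
    (hP : ∀ q, (∃! u, T.Adj q u) → ∀ (m : ℕ) (f : Fin m → V), Function.Injective f →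
      (∀ a, f a ≠ q) → 0 < (A.submatrix f f).det)
    {σ : V → ℝ} (hσ₁ : ∀ i, σ i * σ i = 1) (hσ : ∀ u v, T.Adj u v → σ u = -σ v)
    {p : V} (hp : ∃! u, T.Adj p u) (i : V) :
    0 < σ p * σ i * A⁻¹ p i := by
  induction hn : Fintype.card V generalizing V with
  | zero => exact absurd hn (Fintype.card_pos_iff.mpr ⟨p⟩).ne'
  | succ n ih =>
  by_cases hfew : ∀ q r, q ≠ p → r ≠ p → (∃! u, T.Adj q u) → (∃! u, T.Adj r u) → q = r
  · obtain ⟨u, hu, -⟩ := hp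
    have : Nontrivial V := ⟨p, u, hu.ne⟩
    obtain ⟨v, w, hw, hcov⟩ := hT.exists_isPath_covering p hfew
    exact inv_sign_of_isPath_covering hσ₁ hσ hw hcov (hTP _ _ w hw) i
  push Not at hfew
  obtain ⟨q, r, hqp, hrp, hq, hr, hqr⟩ := hfew
  have hsub (b : V) (hb : ∃! u, T.Adj b u) :
      0 < (A.submatrix (Subtype.val : {i // i ≠ b} → V) Subtype.val).det := by
    let e := (Fintype.equivFin {i // i ≠ b}).symm
    have := hP b hb _ (fun a ↦ (e a : V)) (Subtype.val_injective.comp e.injective) fun a ↦ (e a).2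
    rwa [← Matrix.det_submatrix_equiv_self e]
  have hdiag (b : V) (hb : ∃! u, T.Adj b u) : 0 < σ b * σ b * A⁻¹ b b := by
    rw [hσ₁, one_mul]
    exact Matrix.inv_apply_self_pos hdet (hsub b hb)
  have hschur {a b c j : V} (ha : ∃! u, T.Adj a u) (hb : ∃! u, T.Adj b u) (hab : a ≠ b)
      (hac : a ≠ c) (hbc : b ≠ c) (hj : j ≠ b) :
      (σ a * σ b * A⁻¹ a b) * (σ b * σ j * A⁻¹ b j) <
        (σ a * σ j * A⁻¹ a j) * (σ b * σ b * A⁻¹ b b) := by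
    have hbb : 0 < A⁻¹ b b := by simpa [hσ₁] using hdiag b hb
    have key := ih (V := {i // i ≠ b}) (T := T.induce {i | i ≠ b})
      (A := A.submatrix Subtype.val Subtype.val) (σ := fun i ↦ σ i) (p := ⟨a, hab⟩)
      (hT.induce_ne_of_existsUnique_adj hb)
      (fun _ _ _ hw ↦ isTotallyPositive_pathMatrix_induce hTP _ hw)
      (hsub b hb)
      (fun d hd m f hf hfd ↦ hP b hb m (fun s ↦ (f s : V)) (Subtype.val_injective.comp hf)
        fun s ↦ (f s).2)
      (fun i ↦ hσ₁ i) (fun u v huv ↦ hσ _ _ huv)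
      (hT.existsUnique_adj_induce_ne ha hb hab hac hbc) ⟨j, hj⟩
      (by rw [Fintype.card_subtype_compl, hn]; simp)
    rw [Matrix.inv_submatrix_ne hdet.ne'.isUnit hbb.ne', Matrix.of_apply] at key
    have := mul_pos key hbb
    rw [mul_assoc, sub_mul, div_mul_cancel₀ _ hbb.ne'] at this
    linear_combination this + σ a * σ j * A⁻¹ a b * A⁻¹ b j * hσ₁ b -
      σ a * σ j * A⁻¹ a j * A⁻¹ b b * hσ₁ b
  have hdom {a b c j : V} (ha : ∃! u, T.Adj a u) (hb : ∃! u, T.Adj b u) (hab : a ≠ b)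
      (hac : a ≠ c) (hbc : b ≠ c) (hja : j ≠ a) (hjb : j ≠ b) (hnonneg : 0 ≤ σ a * σ b * A⁻¹ a b) :
      0 < σ a * σ j * A⁻¹ a j :=
    pos_of_cyclic_dominance (hdiag a ha) hnonneg (hschur ha hb hab hac hbc hjb)
      (hschur hb ha hab.symm hbc hac hja) (hschur ha hb hab hac hbc hab)
  have hleaf {a b c : V} (ha : ∃! u, T.Adj a u) (hb : ∃! u, T.Adj b u) (hc : ∃! u, T.Adj c u)
      (hab : a ≠ b) (hac : a ≠ c) (hbc : b ≠ c) : 0 < σ a * σ b * A⁻¹ a b := by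
    by_contra! hneg
    have hac_neg : σ a * σ c * A⁻¹ a c < 0 := by
      by_contra! hac_nonneg
      exact hneg.not_gt (hdom ha hc hac hab hbc.symm hab.symm hbc hac_nonneg)
    have habc := hschur ha hc hac hab hbc.symm hbc
    have hacb := hschur ha hb hab hac hbc hbc.symm
    have hcb := hschur hc hb hbc.symm hac.symm hab.symm hbc.symm
    have hcb_nonneg : 0 ≤ σ c * σ b * A⁻¹ c b := by
      by_contra! hcb_neg
      linarith [mul_pos_of_neg_of_neg hac_neg hcb_neg,
        mul_nonpos_of_nonpos_of_nonneg hneg (hdiag c hc).le]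
    rw [mul_comm] at habc hacb
    rw [mul_comm (σ c * σ c * _)] at hcb
    exact hneg.not_gt (pos_of_cyclic_dominance (hdiag b hb) hcb_nonneg habc hacb hcb)
  obtain rfl | hip := eq_or_ne i p
  · exact hdiag i hp
  have hpq := hleaf hp hq hr hqp.symm hrp.symm hqr
  obtain rfl | hiq := eq_or_ne i q
  · exact hpq
  exact hdom hp hq hqp.symm hrp.symm hqr hip hiq hpq.le

/-- Lemma 2.5: for every pendant vertex `p` and every index `i`,
`sign(ã_{p,i}) = σ_p σ_i`; in particular `ã_{p,p} > 0`. -/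
theorem ttp_adjugate_sign_pendant_row {n : ℕ} (T : SimpleGraph (Fin n)) (hT : T.IsTree)
    (A : Matrix (Fin n) (Fin n) ℝ) (hTTP : IsTTP T A) (hdet : 0 < A.det)
    (hP : ∀ q : Fin n, Pendant T q → IsPMatrix (deleteVertex A q))
    (σ : Fin n → ℝ) (hσ : IsSigning T σ)
    (p : Fin n) (hp : Pendant T p) :
    (∀ i : Fin n, 0 < σ p * σ i * A.adjugate p i) ∧ 0 < A.adjugate p p := by
  have hσ₁ (i : Fin n) : σ i * σ i = 1 := by
    rcases hσ.1 i with h | h <;> simp [h]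
  have hminor (q : Fin n) (hq : Pendant T q) (m : ℕ) (f : Fin m → Fin n)
      (hf : Function.Injective f) (hfq : ∀ a, f a ≠ q) : 0 < (A.submatrix f f).det := by
    let g : Fin m ↪ {i : Fin n // i ≠ q} :=
      ⟨fun a ↦ ⟨f a, hfq a⟩, fun _ _ hab ↦ hf (congrArg Subtype.val hab)⟩
    have hpos := hP q hq (Finset.univ.map g)
    let e : Fin m ≃ {x // x ∈ Finset.univ.map g} :=
      Equiv.ofBijective (fun a ↦ ⟨g a, by simp⟩)
        ⟨fun _ _ hab ↦ g.injective (congrArg Subtype.val hab), fun ⟨x, hx⟩ ↦ by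
          obtain ⟨a, -, rfl⟩ := Finset.mem_map.mp hx
          exact ⟨a, rfl⟩⟩
    rw [← Matrix.det_submatrix_equiv_self e] at hpos
    exact hpos
  have hsign (i : Fin n) : 0 < σ p * σ i * A.adjugate p i := by
    have hinv := inv_sign_pendant_row hT (fun _ _ _ hw ↦ hTTP.pathMatrix hw) hdet hminor hσ₁ hσ.2
      hp i
    rw [Matrix.inv_def, Matrix.smul_apply, Ring.inverse_eq_inv', smul_eq_mul] at hinv
    have := mul_pos hdet hinv
    rwa [mul_left_comm, mul_inv_cancel_left₀ hdet.ne'] at this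
  exact ⟨hsign, by simpa [hσ₁] using hsign p⟩
end
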